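/- Let B ≥ 1, r ≥ 1, H ≥ 1, D' ≤ D, N ≥ 1, and let g be a self-attention layer with H heads and parameters K_h, Q_h ∈ ℝ^{D'×D}, V_h ∈ ℝ^{D×D} all having entrywise maximum absolute value at most B. Then for all X, X' ∈ ℝ^{D×N} whose entries lie in [−r, r] and every column index i, ‖g(X)_i − g(X')_i‖_∞ ≤ 6 H B³ D⁴ r² · ‖X − X'‖_∞. -/

import Mathlib

open Matrix

/-- Softmax of a vector in ℝ^n: `softmax x i = exp (x i) / ∑ j, exp (x j)`. -/
noncomputable def softmax {n : ℕ} (x : Fin n → ℝ) : Fin n → ℝ :=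
  fun i => Real.exp (x i) / ∑ j, Real.exp (x j)

/-- The `i`-th output column of an `H`-head self-attention layer with parameters
`K_h, Q_h ∈ ℝ^{D'×D}`, `V_h ∈ ℝ^{D×D}` applied to `X ∈ ℝ^{D×N}`:
`g(X)_i = x_i + ∑_h V_h X Softmax((K_h X)ᵀ (Q_h x_i))`. -/
noncomputable def attnCol {D Dp N : ℕ} (H : ℕ)
    (K Q : Fin H → Matrix (Fin Dp) (Fin D) ℝ) (V : Fin H → Matrix (Fin D) (Fin D) ℝ)
    (X : Matrix (Fin D) (Fin N) ℝ) (i : Fin N) : Fin D → ℝ :=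
  (fun k => X k i) +
    ∑ h : Fin H,
      (V h) *ᵥ (X *ᵥ softmax (fun m : Fin N =>
        ∑ a, (K h *ᵥ fun k => X k m) a * (Q h *ᵥ fun k => X k i) a))

/-- A sum of `n` products whose factors are bounded by `a` and `b` is bounded by `n * (a * b)`. -/
theorem abs_sum_mul_le {n : ℕ} {f g : Fin n → ℝ} {a b : ℝ} (ha : 0 ≤ a)
    (hf : ∀ i, |f i| ≤ a) (hg : ∀ i, |g i| ≤ b) : |∑ i, f i * g i| ≤ n * (a * b) := by
  calc |∑ i, f i * g i| ≤ ∑ i, |f i * g i| := Finset.abs_sum_le_sum_abs _ _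
    _ ≤ ∑ _i : Fin n, a * b := by
        refine Finset.sum_le_sum fun i _ => ?_
        rw [abs_mul]
        exact mul_le_mul (hf i) (hg i) (abs_nonneg _) ha
    _ = n * (a * b) := by simp

/-- A sum with nonnegative weights `w` of terms bounded by `a` is at most `a * ∑ w`. -/
theorem abs_sum_mul_weight_le {n : ℕ} {f w : Fin n → ℝ} {a : ℝ} (hw : ∀ i, 0 ≤ w i)
    (hf : ∀ i, |f i| ≤ a) : |∑ i, f i * w i| ≤ a * ∑ i, w i := by
  rw [Finset.mul_sum]
  refine (Finset.abs_sum_le_sum_abs _ _).trans (Finset.sum_le_sum fun i _ => ?_)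
  rw [abs_mul, abs_of_nonneg (hw i)]
  exact mul_le_mul_of_nonneg_right (hf i) (hw i)

theorem softmax_nonneg {n : ℕ} (x : Fin n → ℝ) (i : Fin n) : 0 ≤ softmax x i := by
  unfold softmax
  positivity

theorem sum_exp_pos {n : ℕ} [NeZero n] (x : Fin n → ℝ) : 0 < ∑ j, Real.exp (x j) :=
  Finset.sum_pos (fun _ _ => Real.exp_pos _) Finset.univ_nonempty

theorem sum_softmax {n : ℕ} [NeZero n] (x : Fin n → ℝ) : ∑ i, softmax x i = 1 := by
  simp only [softmax]
  rw [← Finset.sum_div, div_self (sum_exp_pos x).ne']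

theorem sum_mul_softmax {n : ℕ} (c x : Fin n → ℝ) :
    ∑ i, c i * softmax x i = (∑ i, c i * Real.exp (x i)) / ∑ i, Real.exp (x i) := by
  simp only [softmax]
  rw [Finset.sum_div]
  exact Finset.sum_congr rfl fun i _ => (mul_div_assoc _ _ _).symm

/-- Softmax averages of values bounded by `r` are `2 * r`-Lipschitz in the logits for the
sup norm. -/
theorem abs_sum_mul_softmax_sub_le {n : ℕ} [NeZero n] {c x y : Fin n → ℝ} {r ε : ℝ}
    (hc : ∀ i, |c i| ≤ r) (hxy : ∀ i, |x i - y i| ≤ ε) :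
    |∑ i, c i * softmax x i - ∑ i, c i * softmax y i| ≤ 2 * r * ε := by
  set d : Fin n → ℝ := fun i => x i - y i with hd
  set e : ℝ → Fin n → ℝ := fun t i => Real.exp (y i + t * d i) with he
  have hr : 0 ≤ r := (abs_nonneg _).trans (hc 0)
  have hpos : ∀ t, 0 < ∑ i, e t i := fun t => sum_exp_pos _
  have hderiv_e : ∀ t i, HasDerivAt (fun t => e t i) (d i * e t i) t := fun t i => by
    have h := (((hasDerivAt_id t).mul_const (d i)).const_add (y i)).exp
    simpa [he, mul_comm] using h
  have hnum : ∀ t, HasDerivAt (fun t => ∑ i, c i * e t i) (∑ i, c i * (d i * e t i)) t :=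
    fun t => HasDerivAt.fun_sum fun i _ => (hderiv_e t i).const_mul (c i)
  have hden : ∀ t, HasDerivAt (fun t => ∑ i, e t i) (∑ i, d i * e t i) t :=
    fun t => HasDerivAt.fun_sum fun i _ => hderiv_e t i
  have hderiv := fun t => (hnum t).fun_div (hden t) (hpos t).ne'
  have hbound : ∀ t, ‖((∑ i, c i * (d i * e t i)) * ∑ i, e t i
      - (∑ i, c i * e t i) * ∑ i, d i * e t i) / (∑ i, e t i) ^ 2‖ ≤ 2 * r * ε := fun t => by
    have hW := hpos t
    have hnonneg : ∀ i, 0 ≤ e t i := fun i => (Real.exp_pos _).le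
    have hcd : |∑ i, c i * (d i * e t i)| ≤ r * ε * ∑ i, e t i := by
      simp only [← mul_assoc]
      refine abs_sum_mul_weight_le hnonneg fun i => ?_
      rw [abs_mul]
      exact mul_le_mul (hc i) (hxy i) (abs_nonneg _) hr
    have hc' : |∑ i, c i * e t i| ≤ r * ∑ i, e t i := abs_sum_mul_weight_le hnonneg hc
    have hd' : |∑ i, d i * e t i| ≤ ε * ∑ i, e t i := abs_sum_mul_weight_le hnonneg hxy
    rw [Real.norm_eq_abs, abs_div, abs_of_pos (pow_pos hW 2), div_le_iff₀ (pow_pos hW 2)]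
    refine (abs_sub _ _).trans ?_
    rw [abs_mul, abs_mul, abs_of_pos hW]
    have h₁ := mul_le_mul_of_nonneg_right hcd hW.le
    have h₂ := mul_le_mul hc' hd' (abs_nonneg _) (mul_nonneg hr hW.le)
    linarith
  have hmvt := convex_univ.norm_image_sub_le_of_norm_hasDerivWithin_le (𝕜 := ℝ)
    (fun t _ => (hderiv t).hasDerivWithinAt) (fun t _ => hbound t)
    (Set.mem_univ 0) (Set.mem_univ 1)
  simpa [sum_mul_softmax, he, hd] using hmvt

theorem abs_mul_sub_mul_le {a b a' b' M δ : ℝ} (ha : |a| ≤ M) (hb' : |b'| ≤ M)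
    (haa : |a - a'| ≤ δ) (hbb : |b - b'| ≤ δ) : |a * b - a' * b'| ≤ 2 * M * δ := by
  have h : a * b - a' * b' = a * (b - b') + (a - a') * b' := by ring
  rw [h]
  refine (abs_add_le _ _).trans ?_
  rw [abs_mul, abs_mul]
  have h₁ := mul_le_mul ha hbb (abs_nonneg _) ((abs_nonneg _).trans ha)
  have h₂ := mul_le_mul haa hb' (abs_nonneg _) ((abs_nonneg _).trans haa)
  linarith

theorem abs_mulVec_le {m n : ℕ} {A : Matrix (Fin m) (Fin n) ℝ} {x : Fin n → ℝ} {B r : ℝ}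
    (hB : 0 ≤ B) (hA : ∀ a i, |A a i| ≤ B) (hx : ∀ i, |x i| ≤ r) (a : Fin m) :
    |(A *ᵥ x) a| ≤ n * (B * r) :=
  abs_sum_mul_le hB (hA a) hx

theorem abs_mulVec_sub_le {m n : ℕ} {A : Matrix (Fin m) (Fin n) ℝ} {x y : Fin n → ℝ} {B δ : ℝ}
    (hB : 0 ≤ B) (hA : ∀ a i, |A a i| ≤ B) (hxy : ∀ i, |x i - y i| ≤ δ) (a : Fin m) :
    |(A *ᵥ x) a - (A *ᵥ y) a| ≤ n * (B * δ) := by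
  rw [← Pi.sub_apply, ← Matrix.mulVec_sub]
  exact abs_mulVec_le hB hA hxy a

/-- Lipschitz bound for an attention logit `⟨K x, Q y⟩` on the box of radius `r`. -/
theorem abs_logit_sub_le {m n : ℕ} {K Q : Matrix (Fin m) (Fin n) ℝ} {x y x' y' : Fin n → ℝ}
    {B r δ : ℝ} (hB : 0 ≤ B) (hK : ∀ a i, |K a i| ≤ B) (hQ : ∀ a i, |Q a i| ≤ B)
    (hx : ∀ i, |x i| ≤ r) (hy' : ∀ i, |y' i| ≤ r)
    (hxx : ∀ i, |x i - x' i| ≤ δ) (hyy : ∀ i, |y i - y' i| ≤ δ) :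
    |∑ a, (K *ᵥ x) a * (Q *ᵥ y) a - ∑ a, (K *ᵥ x') a * (Q *ᵥ y') a| ≤
      m * (2 * (n * (B * r)) * (n * (B * δ))) := by
  rw [← Finset.sum_sub_distrib]
  refine (Finset.abs_sum_le_sum_abs _ _).trans ?_
  refine (Finset.sum_le_card_nsmul _ _ _ fun a _ =>
    abs_mul_sub_mul_le (abs_mulVec_le hB hK hx a) (abs_mulVec_le hB hQ hy' a)
      (abs_mulVec_sub_le hB hK hxx a) (abs_mulVec_sub_le hB hQ hyy a)).trans ?_
  simp

/-- Lipschitz bound for a softmax average in both the averaged values and the logits. -/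
theorem abs_mulVec_softmax_sub_le {m n : ℕ} [NeZero n] {X X' : Matrix (Fin m) (Fin n) ℝ}
    {z z' : Fin n → ℝ} {r δ ε : ℝ} (hX : ∀ k j, |X k j| ≤ r)
    (hXX : ∀ k j, |X k j - X' k j| ≤ δ) (hz : ∀ j, |z j - z' j| ≤ ε) (k : Fin m) :
    |(X *ᵥ softmax z) k - (X' *ᵥ softmax z') k| ≤ 2 * r * ε + δ := by
  have h₁ := abs_sum_mul_softmax_sub_le (hX k) hz
  have h₂ : |∑ j, (X k j - X' k j) * softmax z' j| ≤ δ := by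
    simpa [sum_softmax] using abs_sum_mul_weight_le (softmax_nonneg z') (hXX k)
  have h : (X *ᵥ softmax z) k - (X' *ᵥ softmax z') k =
      (∑ j, X k j * softmax z j - ∑ j, X k j * softmax z' j) +
        ∑ j, (X k j - X' k j) * softmax z' j := by
    simp only [Matrix.mulVec, dotProduct, sub_mul, Finset.sum_sub_distrib]
    ring
  rw [h]
  exact (abs_add_le _ _).trans (add_le_add h₁ h₂)

/-- Lipschitz bound for a self-attention layer:
`‖g(X)_i − g(X')_i‖_∞ ≤ 6 H B³ D⁴ r² ‖X − X'‖_∞`. -/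
theorem attention_lipschitz (D Dp N H : ℕ) (hDp : Dp ≤ D) (hN : 1 ≤ N) (hH : 1 ≤ H)
    (B r : ℝ) (hB : 1 ≤ B) (hr : 1 ≤ r)
    (K Q : Fin H → Matrix (Fin Dp) (Fin D) ℝ) (V : Fin H → Matrix (Fin D) (Fin D) ℝ)
    (hK : ∀ h a i, |K h a i| ≤ B) (hQ : ∀ h a i, |Q h a i| ≤ B)
    (hV : ∀ h k i, |V h k i| ≤ B)
    (X X' : Matrix (Fin D) (Fin N) ℝ)
    (hX : ∀ k m, |X k m| ≤ r) (hX' : ∀ k m, |X' k m| ≤ r) :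
    ∀ (i : Fin N) (k : Fin D),
      |attnCol H K Q V X i k - attnCol H K Q V X' i k| ≤
        6 * H * B ^ 3 * (D : ℝ) ^ 4 * r ^ 2 * ⨆ a, ⨆ m, |X a m - X' a m| := by
  intro i k
  have : NeZero N := ⟨by omega⟩
  set δ : ℝ := ⨆ a, ⨆ m, |X a m - X' a m|
  have hδ : ∀ a m, |X a m - X' a m| ≤ δ := fun a m =>
    (le_ciSup (f := fun m => |X a m - X' a m|) (Set.finite_range _).bddAbove m).trans
      (le_ciSup (f := fun a => ⨆ m, |X a m - X' a m|) (Set.finite_range _).bddAbove a)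
  have hδ0 : 0 ≤ δ := (abs_nonneg _).trans (hδ k i)
  have hB0 : 0 ≤ B := zero_le_one.trans hB
  have hr0 : 0 ≤ r := zero_le_one.trans hr
  have hD : (1 : ℝ) ≤ D := by exact_mod_cast Fin.pos k
  have hD0 : (0 : ℝ) ≤ D := zero_le_one.trans hD
  have hDpD : (Dp : ℝ) ≤ D := by exact_mod_cast hDp
  have hH' : (1 : ℝ) ≤ H := by exact_mod_cast hH
  have hhead : ∀ h, |(V h *ᵥ (X *ᵥ softmax (fun m : Fin N =>
        ∑ a, (K h *ᵥ fun k => X k m) a * (Q h *ᵥ fun k => X k i) a))) k -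
      (V h *ᵥ (X' *ᵥ softmax (fun m : Fin N =>
        ∑ a, (K h *ᵥ fun k => X' k m) a * (Q h *ᵥ fun k => X' k i) a))) k| ≤
      D * (B * (2 * r * (D * (2 * (D * (B * r)) * (D * (B * δ)))) + δ)) := fun h => by
    refine abs_mulVec_sub_le hB0 (hV h) (fun l => ?_) k
    refine abs_mulVec_softmax_sub_le hX hδ (fun m => ?_) l
    refine (abs_logit_sub_le hB0 (hK h) (hQ h) (fun l => hX l m) (fun l => hX' l i)
      (fun l => hδ l m) (fun l => hδ l i)).trans ?_
    gcongr
  have hsum : |attnCol H K Q V X i k - attnCol H K Q V X' i k| ≤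
      δ + H * (D * (B * (2 * r * (D * (2 * (D * (B * r)) * (D * (B * δ)))) + δ))) := by
    simp only [attnCol, Pi.add_apply, Finset.sum_apply]
    rw [add_sub_add_comm, ← Finset.sum_sub_distrib]
    refine (abs_add_le _ _).trans (add_le_add (hδ k i) ?_)
    refine (Finset.abs_sum_le_sum_abs _ _).trans ?_
    refine (Finset.sum_le_card_nsmul _ _ _ fun h _ => hhead h).trans ?_
    simp
  have hHBD : (H : ℝ) * D * B ≤ H * B ^ 3 * (D : ℝ) ^ 4 * r ^ 2 := by
    calc (H : ℝ) * D * B = H * B ^ 1 * (D : ℝ) ^ 1 * 1 := by ring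
      _ ≤ H * B ^ 3 * (D : ℝ) ^ 4 * r ^ 2 := by
          gcongr
          · norm_num
          · norm_num
          · exact one_le_pow₀ hr
  have hone : (1 : ℝ) ≤ H * D * B :=
    one_le_mul_of_one_le_of_one_le (one_le_mul_of_one_le_of_one_le hH' hD) hB
  have h₁ := mul_le_mul_of_nonneg_right hHBD hδ0
  have h₂ := mul_le_mul_of_nonneg_right hone hδ0
  refine hsum.trans ?_
  linarith
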